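/- Let F be the finite directed graph with vertices v_1, v_2, v_3 and edges consisting of two loops at v_1, one edge from v_1 to v_2, and one edge from v_2 to v_3, and let E be the graph obtained from F by adding a new vertex v_0 and a single edge from v_0 to v_1 (so that F is obtained from E by eliminating the source v_0). Then the graph monoid M_F satisfies: for all positive integers m, n, m·[v_1 + v_2 + v_3] = n·[v_1 + v_2 + v_3] in M_F implies m = n; whereas there exist distinct positive integers m and n with m·[v_0 + v_1 + v_2 + v_3] = n·[v_0 + v_1 + v_2 + v_3] in M_E. -/

import Mathlib

open Finset

/-- The defining relations of the graph monoid of a finite graph with edge set `Ed`, source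
map `s` and range map `r`: for each regular vertex `v` (one emitting at least one edge),
`v = ∑_{e ∈ s⁻¹(v)} r(e)` in the free commutative monoid on the vertices. -/
def graphRel {V Ed : Type} [Fintype Ed] [DecidableEq V] (s r : Ed → V) :
    (V →₀ ℕ) → (V →₀ ℕ) → Prop := fun x y =>
  ∃ v : V, (∃ e, s e = v) ∧ x = Finsupp.single v 1 ∧
    y = ∑ e ∈ univ.filter (fun e => s e = v), Finsupp.single (r e) 1

/-- The congruence on the free commutative monoid on the vertices generated by the graph
relations; the graph monoid `M_E` is its quotient `(graphCon s r).Quotient`. -/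
noncomputable def graphCon {V Ed : Type} [Fintype Ed] [DecidableEq V] (s r : Ed → V) :
    AddCon (V →₀ ℕ) := addConGen (graphRel s r)

/-- Source map of the graph `F` with vertices `v₁, v₂, v₃` (namely `0, 1, 2 : Fin 3`) and
four edges: two loops at `v₁`, one edge `v₁ → v₂`, one edge `v₂ → v₃`. -/
def sF : Fin 4 → Fin 3 := ![0, 0, 0, 1]

/-- Range map of the graph `F`. -/
def rF : Fin 4 → Fin 3 := ![0, 0, 1, 2]

/-- Source map of the graph `E`, obtained from `F` by adding a new vertex `v₀` (namely
`0 : Fin 4`, with `v₁, v₂, v₃` being `1, 2, 3 : Fin 4`) and a single edge `v₀ → v₁`: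
its five edges are `v₀ → v₁`, two loops at `v₁`, one edge `v₁ → v₂`, one edge `v₂ → v₃`. -/
def sE : Fin 5 → Fin 4 := ![0, 1, 1, 1, 2]

/-- Range map of the graph `E`. -/
def rE : Fin 5 → Fin 4 := ![1, 1, 1, 2, 3]

/-- In the graph monoid, a regular vertex equals the sum of the ranges of the edges it emits. -/
theorem mk'_single_eq_sum {V Ed : Type} [Fintype Ed] [DecidableEq V] (s r : Ed → V) (v : V)
    (hv : ∃ e, s e = v) :
    (graphCon s r).mk' (Finsupp.single v 1) =
      ∑ e ∈ univ.filter (fun e => s e = v), (graphCon s r).mk' (Finsupp.single (r e) 1) := by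
  rw [← map_sum]
  exact (AddCon.eq _).2 (AddConGen.Rel.of _ _ ⟨v, hv, rfl, rfl⟩)

/-- The additive functional on the free commutative monoid on the vertices with weights `w`. -/
noncomputable def weightHom {V : Type} (w : V → ℤ) : (V →₀ ℕ) →+ ℤ :=
  Finsupp.liftAddHom fun v => (AddMonoidHom.mulRight (w v)).comp (Nat.castAddMonoidHom ℤ)

@[simp]
theorem weightHom_single {V : Type} (w : V → ℤ) (v : V) :
    weightHom w (Finsupp.single v 1) = w v := by
  simp [weightHom]

/-- Weights that satisfy the graph relations define an invariant of the graph monoid. -/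
theorem weightHom_eq_of_mk'_eq {V Ed : Type} [Fintype Ed] [DecidableEq V] (s r : Ed → V)
    (w : V → ℤ)
    (hw : ∀ v, (∃ e, s e = v) → w v = ∑ e ∈ univ.filter (fun e => s e = v), w (r e))
    {x y : V →₀ ℕ} (h : (graphCon s r).mk' x = (graphCon s r).mk' y) :
    weightHom w x = weightHom w y := by
  have hle : graphCon s r ≤ AddCon.ker (weightHom w) := by
    refine AddCon.addConGen_le.2 ?_
    rintro _ _ ⟨v, hv, rfl, rfl⟩
    simpa [AddCon.ker_rel] using hw v hv
  exact AddCon.ker_rel _ |>.1 (hle ((AddCon.eq _).1 h))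

/-- The graph monoid `M_F` satisfies: for all positive integers `m, n`,
`m·[v₁ + v₂ + v₃] = n·[v₁ + v₂ + v₃]` in `M_F` implies `m = n`; whereas there exist
distinct positive integers `m` and `n` with
`m·[v₀ + v₁ + v₂ + v₃] = n·[v₀ + v₁ + v₂ + v₃]` in `M_E`. -/
theorem stmt12 :
    (∀ m n : ℕ, 0 < m → 0 < n →
        m • (graphCon sF rF).mk' (∑ v : Fin 3, Finsupp.single v 1) =
          n • (graphCon sF rF).mk' (∑ v : Fin 3, Finsupp.single v 1) → m = n) ∧
      (∃ m n : ℕ, 0 < m ∧ 0 < n ∧ m ≠ n ∧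
        m • (graphCon sE rE).mk' (∑ v : Fin 4, Finsupp.single v 1) =
          n • (graphCon sE rE).mk' (∑ v : Fin 4, Finsupp.single v 1)) := by
  constructor
  · intro m n _ _ h
    rw [← map_nsmul, ← map_nsmul] at h
    have hw := weightHom_eq_of_mk'_eq sF rF ![-1, 1, 1] (by
      rintro v ⟨e, rfl⟩
      fin_cases e <;> decide) h
    rw [map_nsmul, map_nsmul] at hw
    simpa [Fin.sum_univ_three] using hw
  · refine ⟨1, 2, one_pos, two_pos, by decide, ?_⟩
    have h0 := mk'_single_eq_sum sE rE 0 ⟨0, rfl⟩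
    have h1 := mk'_single_eq_sum sE rE 1 ⟨1, rfl⟩
    have h2 := mk'_single_eq_sum sE rE 2 ⟨4, rfl⟩
    rw [show univ.filter (fun e => sE e = 0) = {0} by decide, sum_singleton] at h0
    rw [show univ.filter (fun e => sE e = 1) = {1, 2, 3} by decide,
      sum_insert (by decide), sum_insert (by decide), sum_singleton] at h1
    rw [show univ.filter (fun e => sE e = 2) = {4} by decide, sum_singleton] at h2
    rw [map_sum, Fin.sum_univ_four, h0, ← show rE 4 = 3 from rfl, ← h2, one_nsmul, two_nsmul]
    change _ = (graphCon sE rE).mk' (Finsupp.single 1 1) +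
      ((graphCon sE rE).mk' (Finsupp.single 1 1) + (graphCon sE rE).mk' (Finsupp.single 2 1)) at h1
    change (graphCon sE rE).mk' (Finsupp.single 1 1) + _ + _ + _ =
      (graphCon sE rE).mk' (Finsupp.single 1 1) + _ + _ + _ +
        ((graphCon sE rE).mk' (Finsupp.single 1 1) + _ + _ + _)
    generalize (graphCon sE rE).mk' (Finsupp.single 1 1) = a at *
    generalize (graphCon sE rE).mk' (Finsupp.single 2 1) = b at *
    have hw : (a + b) + (a + b) = a + b := by
      calc (a + b) + (a + b) = (a + (a + b)) + b := by abel
        _ = a + b := by rw [← h1]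
    calc a + a + b + b = (a + b) + (a + b) := by abel
      _ = ((a + b) + (a + b)) + ((a + b) + (a + b)) := by rw [hw, hw]
      _ = a + a + b + b + (a + a + b + b) := by abel
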